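/- Let d, n ≥ 2, V(x) = |x|², β_n > 0, and let X_n = (X_{n,1},…,X_{n,n}) be distributed according to the Gibbs measure P_n on (ℝ^d)^n with density proportional to exp(−β_n H_n(x_1,…,x_n)), where H_n(x) = (1/n)Σ_i V(x_i) + (1/n²)Σ_{i≠j} g(x_i−x_j). Let v ∈ ℝ^d with |v| = 1, c ∈ ℝ, and φ(x) = x·v − c. If Y_n is distributed according to the law of X_n conditioned on (1/n)Σ_i φ(X_{n,i}) = 0, then Y_n has the same distribution as X_n + (c − ((X_{n,1}+⋯+X_{n,n})/n)·v)(v,…,v). -/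

import Mathlib

open MeasureTheory Filter Metric
open scoped ENNReal NNReal RealInnerProductSpace BigOperators Topology ProbabilityTheory Classical

noncomputable section

/-- `ℝ^d` as a Euclidean space. -/
abbrev Euc (d : ℕ) : Type := EuclideanSpace ℝ (Fin d)

/-- The Coulomb kernel `g`, valued in `ℝ ∪ {+∞}` (`= ⊤` at the origin). -/
noncomputable def coulombK (d : ℕ) (x : Euc d) : EReal :=
  if x = 0 then ⊤
  else if d = 2 then ((Real.log (1 / ‖x‖) : ℝ) : EReal)
  else ((1 / (((d : ℝ) - 2) * ‖x‖ ^ ((d : ℕ) - 2)) : ℝ) : EReal)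

/-- Positive part of an extended real, as an extended nonnegative real. -/
noncomputable def posP (x : EReal) : ℝ≥0∞ := if x = ⊤ then ⊤ else ENNReal.ofReal x.toReal

/-- The electrostatic energy `E(μ) = ∬ (g(x-y) + (V x + V y)/2) dμ dμ`, valued in `EReal`,
defined as the difference of the integrals of the positive and negative parts of the
integrand. -/
noncomputable def energy (d : ℕ) (V : Euc d → ℝ) (μ : Measure (Euc d)) : EReal :=
  ((∫⁻ q : Euc d × Euc d,
      posP (coulombK d (q.1 - q.2) + (((V q.1 + V q.2) / 2 : ℝ) : EReal)) ∂(μ.prod μ) : ℝ≥0∞) : EReal)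
  - ((∫⁻ q : Euc d × Euc d,
      posP (-(coulombK d (q.1 - q.2) + (((V q.1 + V q.2) / 2 : ℝ) : EReal))) ∂(μ.prod μ) : ℝ≥0∞) : EReal)

/-- Finiteness of the `p`-th moment of a measure on `ℝ^d`. -/
def FiniteMoment (d : ℕ) (p : ℝ) (μ : Measure (Euc d)) : Prop :=
  ∫⁻ x, ENNReal.ofReal (‖x‖ ^ p) ∂μ ≠ ⊤

/-- Couplings of two measures. -/
def Couplings (d : ℕ) (μ ν : Measure (Euc d)) : Set (Measure (Euc d × Euc d)) :=
  {π | π.map Prod.fst = μ ∧ π.map Prod.snd = ν}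

/-- The `p`-Wasserstein distance (valued in `ℝ≥0∞`). -/
noncomputable def wassDist (d : ℕ) (p : ℝ) (μ ν : Measure (Euc d)) : ℝ≥0∞ :=
  (⨅ π ∈ Couplings d μ ν, ∫⁻ q : Euc d × Euc d, ENNReal.ofReal (‖q.1 - q.2‖ ^ p) ∂π) ^ (1 / p)

/-- Real-valued Coulomb kernel (junk value at the origin; only used in densities with
respect to Lebesgue measure, for which the diagonal is negligible). -/
noncomputable def coulombKR (d : ℕ) (x : Euc d) : ℝ :=
  if d = 2 then Real.log (1 / ‖x‖) else 1 / (((d : ℝ) - 2) * ‖x‖ ^ ((d : ℕ) - 2))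

/-- The Coulomb gas Hamiltonian `H_n`. -/
noncomputable def hamiltonian (d n : ℕ) (V : Euc d → ℝ) (x : Fin n → Euc d) : ℝ :=
  (1 / (n : ℝ)) * ∑ i, V (x i)
    + (1 / (n : ℝ) ^ 2) *
        ∑ q ∈ Finset.univ.filter (fun q : Fin n × Fin n => q.1 ≠ q.2), coulombKR d (x q.1 - x q.2)

/-- The Gibbs measure `P_n` with density proportional to `exp(-β H_n)`. -/
noncomputable def gibbs (d n : ℕ) (β : ℝ) (V : Euc d → ℝ) : Measure (Fin n → Euc d) :=
  ((∫⁻ x, ENNReal.ofReal (Real.exp (-β * hamiltonian d n V x)) ∂(Measure.pi fun _ => volume))⁻¹) •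
    (Measure.pi fun _ => (volume : Measure (Euc d))).withDensity
      (fun x => ENNReal.ofReal (Real.exp (-β * hamiltonian d n V x)))

/-- Empirical measure of a configuration. -/
noncomputable def empMeas (d n : ℕ) (x : Fin n → Euc d) : Measure (Euc d) :=
  ((n : ℝ≥0∞))⁻¹ • ∑ i, Measure.dirac (x i)

/-- Uniform probability measure on the closed ball of radius 1 centered at `c`. -/
noncomputable def uniformBall (d : ℕ) (c : Euc d) : Measure (Euc d) :=
  (volume (Metric.closedBall c 1))⁻¹ • volume.restrict (Metric.closedBall c 1)

/-- Support of a measure. -/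
def measSupport (d : ℕ) (μ : Measure (Euc d)) : Set (Euc d) :=
  {x | ∀ U : Set (Euc d), IsOpen U → x ∈ U → μ U ≠ 0}

/-- The Coulomb interaction energy `J(μ) = ∬ g(x-y) dμ dμ` (the energy with `V = 0`). -/
noncomputable def interactionJ (d : ℕ) (μ : Measure (Euc d)) : EReal :=
  energy d (fun _ => 0) μ

/-- A set has null capacity if it contains no compact set carrying a probability measure
of finite Coulomb interaction energy. -/
def NullCapacity (d : ℕ) (A : Set (Euc d)) : Prop :=
  ∀ K : Set (Euc d), K ⊆ A → IsCompact K →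
    ∀ μ : Measure (Euc d), IsProbabilityMeasure μ → μ Kᶜ = 0 → interactionJ d μ = ⊤

/-- A property holds quasi-everywhere if it holds outside a Borel set of null capacity. -/
def QuasiEverywhere (d : ℕ) (P : Euc d → Prop) : Prop :=
  ∃ N : Set (Euc d), MeasurableSet N ∧ NullCapacity d N ∧ ∀ x ∉ N, P x

/-- The Coulomb potential `(g * μ)(x) = ∫ g(x - y) μ(dy)`, valued in `EReal`. -/
noncomputable def coulombPot (d : ℕ) (μ : Measure (Euc d)) (x : Euc d) : EReal :=
  ((∫⁻ y, posP (coulombK d (x - y)) ∂μ : ℝ≥0∞) : EReal)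
  - ((∫⁻ y, posP (-(coulombK d (x - y))) ∂μ : ℝ≥0∞) : EReal)

/-- The set `P_p(ℝ^d)` of probability measures with finite `p`-th moment. -/
def Ppd (d : ℕ) (p : ℝ) : Set (Measure (Euc d)) :=
  {μ | IsProbabilityMeasure μ ∧ FiniteMoment d p μ}

/-- `B` is closed in the `p`-Wasserstein topology (within `P_p(ℝ^d)`). -/
def WClosedIn (d : ℕ) (p : ℝ) (B : Set (Measure (Euc d))) : Prop :=
  ∀ μ ∈ Ppd d p, (∀ ε : ℝ, 0 < ε → ∃ ν ∈ B, wassDist d p μ ν < ENNReal.ofReal ε) → μ ∈ B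

/-- Interior of `B` in the `p`-Wasserstein topology (within `P_p(ℝ^d)`). -/
def wInterior (d : ℕ) (p : ℝ) (B : Set (Measure (Euc d))) : Set (Measure (Euc d)) :=
  {μ | μ ∈ B ∧ ∃ ε : ℝ, 0 < ε ∧ ∀ ν ∈ Ppd d p, wassDist d p μ ν < ENNReal.ofReal ε → ν ∈ B}

/-- The growth condition `V(x) ≥ a |x|^q - R`. -/
def GrowthCond (d : ℕ) (V : Euc d → ℝ) (a q R : ℝ) : Prop :=
  ∀ x : Euc d, a * ‖x‖ ^ q - R ≤ V x


/-- Tonelli identity for a measure invariant along the direction `w`. -/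
theorem aux_tonelli {E : Type*} [NormedAddCommGroup E] [NormedSpace ℝ E] [MeasurableSpace E]
    (μ : Measure E) [SFinite μ] (w : E)
    (hinv : ∀ (t : ℝ) (F : E → ℝ≥0∞), ∫⁻ x, F (x + t • w) ∂μ = ∫⁻ x, F x ∂μ)
    (s : E → ℝ) (hs : Measurable s) (hst : ∀ x (t : ℝ), s (x + t • w) = s x + t)
    (F : E → ℝ≥0∞) (hF : Measurable F) (hFt : ∀ x (t : ℝ), F (x + t • w) = F x)
    (k q : ℝ → ℝ≥0∞) (hk : Measurable k) (hq : Measurable q) :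
    (∫⁻ t, q t) * ∫⁻ x, F x * k (s x) ∂μ = (∫⁻ u, k u) * ∫⁻ x, F x * q (-(s x)) ∂μ := by
  calc (∫⁻ t, q t) * ∫⁻ x, F x * k (s x) ∂μ
      = ∫⁻ t, q t * ∫⁻ x, F x * k (s x) ∂μ := by
        rw [lintegral_mul_const _ hq]
    _ = ∫⁻ t, ∫⁻ x, q t * (F x * k (s x + t)) ∂μ := by
        refine lintegral_congr fun t => ?_
        rw [lintegral_const_mul _ (by fun_prop), ← hinv t (fun x => F x * k (s x))]
        simp only [hFt, hst]
    _ = ∫⁻ x, (∫⁻ t, q t * (F x * k (s x + t))) ∂μ := by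
        rw [lintegral_lintegral_swap]
        fun_prop
    _ = ∫⁻ x, (∫⁻ u, k u * (F x * q (u - s x))) ∂μ := by
        refine lintegral_congr fun x => ?_
        rw [← lintegral_add_right_eq_self (fun u => k u * (F x * q (u - s x))) (s x)]
        refine lintegral_congr fun t => ?_
        simp only [add_sub_cancel_right]
        rw [add_comm t]
        ring
    _ = ∫⁻ u, ∫⁻ x, k u * (F x * q (u - s x)) ∂μ := by
        rw [lintegral_lintegral_swap]
        fun_prop
    _ = ∫⁻ u, k u * ∫⁻ x, F x * q (-(s x)) ∂μ := by
        refine lintegral_congr fun u => ?_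
        rw [lintegral_const_mul _ (by fun_prop), ← hinv u (fun x => F x * q (u - s x))]
        simp only [hFt, hst]
        congr 1
        refine lintegral_congr fun x => ?_
        congr 2
        ring
    _ = _ := by rw [lintegral_mul_const _ hk]

theorem aux_abstract {E : Type*} [NormedAddCommGroup E] [NormedSpace ℝ E] [MeasurableSpace E]
    [BorelSpace E] [SecondCountableTopology E]
    (μ : Measure E) [SFinite μ] (w : E)
    (hinv : ∀ (t : ℝ) (F : E → ℝ≥0∞), ∫⁻ x, F (x + t • w) ∂μ = ∫⁻ x, F x ∂μ)
    (s : E → ℝ) (hs : Continuous s) (hst : ∀ x (t : ℝ), s (x + t • w) = s x + t)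
    (ρ : E → ℝ≥0∞) (hρm : Measurable ρ) (γ : ℝ → ℝ≥0∞) (hγm : Measurable γ)
    (hγpos : ∀ t, γ t ≠ 0) (hγfin : ∫⁻ t, γ t ≠ ⊤)
    (hρ : ∀ x, ρ x = ρ (x - s x • w) * γ (s x))
    (hZ0 : ∫⁻ x, ρ x ∂μ ≠ 0) (hZ1 : ∫⁻ x, ρ x ∂μ ≠ ⊤)
    (κ : ℝ → Measure E) (hκmeas : Measurable κ)
    (hκprob : ∀ z, IsProbabilityMeasure (κ z))
    (hκsupp : ∀ z : ℝ, κ z {x | s x ≠ z} = 0)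
    (hκcont : ∀ f : BoundedContinuousFunction E ℝ, Continuous fun z => ∫ x, f x ∂(κ z))
    (P : Measure E) (hP : P = (∫⁻ x, ρ x ∂μ)⁻¹ • μ.withDensity ρ)
    (hκdisint : P = (P.map s).bind κ) :
    κ 0 = P.map (fun x => x - s x • w) := by
  have hsm : Measurable s := hs.measurable
  set T : E → E := fun x => x - s x • w with hT
  have hTc : Continuous T := by fun_prop
  have hTm : Measurable T := hTc.measurable
  have hTt : ∀ x (t : ℝ), T (x + t • w) = T x := by
    intro x t
    simp only [hT, hst, add_smul]
    abel
  set Z := ∫⁻ x, ρ x ∂μ with hZ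
  set G := ∫⁻ t, γ t with hG
  have hPint : ∀ f : E → ℝ≥0∞, Measurable f → ∫⁻ x, f x ∂P = Z⁻¹ * ∫⁻ x, ρ x * f x ∂μ := by
    intro f hf
    rw [hP, lintegral_smul_measure, lintegral_withDensity_eq_lintegral_mul _ hρm hf]
    rfl
  haveI hPprob : IsProbabilityMeasure P := by
    constructor
    have := hPint (fun _ => 1) measurable_const
    simp only [lintegral_one, mul_one] at this
    rw [this, ENNReal.inv_mul_cancel hZ0 hZ1]
  have hG0 : G ≠ 0 := by
    rw [hG, Ne, lintegral_eq_zero_iff hγm]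
    intro h
    have h2 : ∀ᵐ t : ℝ, False := h.mono fun t ht => hγpos t ht
    obtain ⟨_, hx⟩ := h2.exists
    exact hx
  -- factorization
  have hfac : ∀ (f : E → ℝ≥0∞) (h : ℝ → ℝ≥0∞), Measurable f → Measurable h →
      G * ∫⁻ x, f (T x) * h (s x) ∂P = (∫⁻ t, h t * γ t) * ∫⁻ x, f (T x) ∂P := by
    intro f h hf hh
    have key := aux_tonelli μ w hinv s hsm hst (fun x => f (T x) * ρ (T x)) (by fun_prop)
      (fun x t => by simp only [hTt]) (fun t => h t * γ t) (fun t => γ (-t)) (by fun_prop)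
      (by fun_prop)
    have hGn : ∫⁻ t, γ (-t) = G := lintegral_neg_eq_self (μ := volume) γ
    rw [hGn] at key
    simp only [neg_neg] at key
    rw [hPint _ (by fun_prop), hPint _ (by fun_prop)]
    have e1 : ∫⁻ x, ρ x * (f (T x) * h (s x)) ∂μ
        = ∫⁻ x, f (T x) * ρ (T x) * (h (s x) * γ (s x)) ∂μ := by
      refine lintegral_congr fun x => ?_
      rw [hρ x]
      ring
    have e2 : ∫⁻ x, ρ x * f (T x) ∂μ = ∫⁻ x, f (T x) * ρ (T x) * γ (s x) ∂μ := by
      refine lintegral_congr fun x => ?_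
      rw [hρ x]
      ring
    rw [e1, e2, mul_left_comm, key]
    ring
  have hfac1 : ∀ h : ℝ → ℝ≥0∞, Measurable h → G * ∫⁻ x, h (s x) ∂P = ∫⁻ t, h t * γ t := by
    intro h hh
    have := hfac (fun _ => 1) h measurable_const hh
    simpa using this
  have hfac2 : ∀ (f : E → ℝ≥0∞) (h : ℝ → ℝ≥0∞), Measurable f → Measurable h →
      ∫⁻ x, f (T x) * h (s x) ∂P = (∫⁻ x, f (T x) ∂P) * ∫⁻ x, h (s x) ∂P := by
    intro f h hf hh
    have h1 := hfac f h hf hh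
    rw [← hfac1 h hh, mul_assoc] at h1
    rw [(ENNReal.mul_right_inj hG0 hγfin).mp h1, mul_comm]
  -- the law of `s`
  set ν := P.map s with hν
  haveI : IsProbabilityMeasure ν := Measure.isProbabilityMeasure_map hsm.aemeasurable
  have hac : (volume : Measure ℝ) ≪ ν := by
    refine Measure.AbsolutelyContinuous.mk fun A hA hA0 => ?_
    have h1 := hfac1 (A.indicator 1) (measurable_one.indicator hA)
    rw [← lintegral_map (measurable_one.indicator hA) hsm, ← hν, lintegral_indicator_one hA, hA0,
      mul_zero] at h1
    have h2 := (lintegral_eq_zero_iff ((measurable_one.indicator hA).mul hγm)).mp h1.symm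
    have h3 : ∀ᵐ t : ℝ, t ∉ A := by
      filter_upwards [h2] with t ht htA
      simp [htA] at ht
      exact hγpos t ht
    simpa [ae_iff] using h3
  haveI : Measure.IsOpenPosMeasure ν := hac.isOpenPosMeasure
  have hsupp : ∀ z, ∀ᵐ x ∂(κ z), s x = z := fun z => by
    rw [ae_iff]
    exact hκsupp z
  haveI : IsProbabilityMeasure (P.map T) := Measure.isProbabilityMeasure_map hTm.aemeasurable
  haveI := hκprob 0
  refine ext_of_forall_lintegral_eq_of_IsFiniteMeasure fun f => ?_
  have hfm : Measurable (fun x => (f x : ℝ≥0∞)) := by fun_prop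
  rw [lintegral_map hfm hTm]
  set a := ∫⁻ x, (f (T x) : ℝ≥0∞) ∂P with ha
  have haeq : (fun z => ∫⁻ x, (f (T x) : ℝ≥0∞) ∂(κ z)) =ᵐ[ν] fun _ => a := by
    have hΦm : Measurable (fun z => ∫⁻ x, (f (T x) : ℝ≥0∞) ∂(κ z)) :=
      (Measure.measurable_lintegral (hfm.comp hTm)).comp hκmeas
    refine ae_eq_of_forall_setLIntegral_eq_of_sigmaFinite hΦm measurable_const fun A hA _ => ?_
    have hh : Measurable (A.indicator (1 : ℝ → ℝ≥0∞)) := measurable_one.indicator hA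
    have h1 := hfac2 (fun x => (f x : ℝ≥0∞)) (A.indicator 1) hfm hh
    rw [← lintegral_map hh hsm, ← hν, lintegral_indicator_one hA] at h1
    rw [setLIntegral_const, ← h1]
    conv_rhs => rw [hκdisint]
    rw [Measure.lintegral_bind hκmeas.aemeasurable (by fun_prop), ← lintegral_indicator hA]
    refine lintegral_congr fun z => ?_
    have : ∫⁻ x, (f (T x) : ℝ≥0∞) * A.indicator 1 (s x) ∂(κ z)
        = ∫⁻ x, (f (T x) : ℝ≥0∞) * A.indicator 1 z ∂(κ z) := by
      refine lintegral_congr_ae ?_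
      filter_upwards [hsupp z] with x hx
      rw [hx]
    rw [this, lintegral_mul_const _ (by fun_prop)]
    by_cases hz : z ∈ A <;> simp [hz]
  have hcont : Continuous (fun z => ∫⁻ x, (f (T x) : ℝ≥0∞) ∂(κ z)) := by
    let fT : BoundedContinuousFunction E NNReal := f.compContinuous ⟨T, hTc⟩
    let g : BoundedContinuousFunction E ℝ :=
      BoundedContinuousFunction.comp (fun y : NNReal => (y : ℝ)) (LipschitzWith.of_dist_le_mul (K := 1) fun a b => by simp [NNReal.dist_eq, Real.dist_eq]) fT
    have hg := hκcont g
    have e : (fun z => ∫⁻ x, (f (T x) : ℝ≥0∞) ∂(κ z))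
        = fun z => ENNReal.ofReal (∫ x, g x ∂(κ z)) := by
      funext z
      haveI := hκprob z
      rw [ofReal_integral_eq_lintegral_ofReal (g.integrable _)
        (Filter.Eventually.of_forall fun x => NNReal.coe_nonneg _)]
      refine lintegral_congr fun x => ?_
      exact (ENNReal.ofReal_coe_nnreal).symm
    rw [e]
    exact ENNReal.continuous_ofReal.comp hg
  have hall := (hcont.ae_eq_iff_eq ν continuous_const).mp haeq
  have h0 := congrFun hall 0
  change _ = a at h0
  rw [← h0]
  refine lintegral_congr_ae ?_
  filter_upwards [hsupp 0] with x hx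
  simp [hT, hx]

theorem aux_coulomb_lower (d : ℕ) (hd : 2 ≤ d) (x : Euc d) :
    -(‖x‖ ^ 2 / 16) - Real.log 8 / 2 ≤ coulombKR d x := by
  have hl : 0 ≤ Real.log 8 := Real.log_nonneg (by norm_num)
  unfold coulombKR
  split_ifs with h
  · by_cases hx : ‖x‖ = 0
    · simp [hx]
      linarith
    · have hpos : 0 < ‖x‖ := lt_of_le_of_ne (norm_nonneg _) (Ne.symm hx)
      have h1 := Real.log_le_sub_one_of_pos (show 0 < ‖x‖ ^ 2 / 8 by positivity)
      rw [Real.log_div (by positivity) (by norm_num), Real.log_pow] at h1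
      rw [one_div, Real.log_inv]
      push_cast at h1
      linarith
  · have h2 : (0 : ℝ) ≤ (d : ℝ) - 2 := by
      have : (2 : ℝ) ≤ d := by exact_mod_cast hd
      linarith
    have : 0 ≤ 1 / (((d : ℝ) - 2) * ‖x‖ ^ ((d : ℕ) - 2)) := by positivity
    nlinarith [sq_nonneg ‖x‖]

theorem aux_coulomb_meas (d : ℕ) : Measurable (coulombKR d) := by
  unfold coulombKR
  split_ifs <;> fun_prop

theorem aux_ham_meas (d n : ℕ) (V : Euc d → ℝ) (hV : ∀ x, V x = ‖x‖ ^ 2) :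
    Measurable (hamiltonian d n V) := by
  have := aux_coulomb_meas d
  have hVm : Measurable V := by
    rw [funext hV]
    fun_prop
  unfold hamiltonian
  fun_prop

theorem aux_ham_lower (d n : ℕ) (hd : 2 ≤ d) (hn : 2 ≤ n) (V : Euc d → ℝ)
    (hV : ∀ x, V x = ‖x‖ ^ 2) (x : Fin n → Euc d) :
    (1 / (2 * (n : ℝ))) * ∑ i, ‖x i‖ ^ 2 - Real.log 8 / 2 ≤ hamiltonian d n V x := by
  have hn0 : (0 : ℝ) < n := by
    have : 0 < n := by omega
    exact_mod_cast this
  have hl : 0 ≤ Real.log 8 := Real.log_nonneg (by norm_num)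
  unfold hamiltonian
  simp only [hV]
  set S := ∑ i, ‖x i‖ ^ 2 with hS
  have hpair : -((n : ℝ) * S / 4) - (n : ℝ) ^ 2 * (Real.log 8 / 2) ≤
      ∑ q ∈ Finset.univ.filter (fun q : Fin n × Fin n => q.1 ≠ q.2),
        coulombKR d (x q.1 - x q.2) := by
    have h1 : ∑ q ∈ Finset.univ.filter (fun q : Fin n × Fin n => q.1 ≠ q.2),
        (‖x q.1‖ ^ 2 / 8 + ‖x q.2‖ ^ 2 / 8 + Real.log 8 / 2) ≤
        ∑ q : Fin n × Fin n, (‖x q.1‖ ^ 2 / 8 + ‖x q.2‖ ^ 2 / 8 + Real.log 8 / 2) :=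
      Finset.sum_le_sum_of_subset_of_nonneg (Finset.filter_subset _ _)
        (fun q _ _ => by positivity)
    have h2 : ∑ q : Fin n × Fin n, (‖x q.1‖ ^ 2 / 8 + ‖x q.2‖ ^ 2 / 8 + Real.log 8 / 2)
        = (n : ℝ) * S / 4 + (n : ℝ) ^ 2 * (Real.log 8 / 2) := by
      rw [Fintype.sum_prod_type]
      simp only [Finset.sum_add_distrib, Finset.sum_const, Finset.card_univ, Fintype.card_fin,
        nsmul_eq_mul, ← Finset.sum_div, ← Finset.mul_sum, ← hS]
      ring
    have h3 : ∑ q ∈ Finset.univ.filter (fun q : Fin n × Fin n => q.1 ≠ q.2),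
        (-(‖x q.1‖ ^ 2 / 8 + ‖x q.2‖ ^ 2 / 8 + Real.log 8 / 2)) ≤
        ∑ q ∈ Finset.univ.filter (fun q : Fin n × Fin n => q.1 ≠ q.2),
        coulombKR d (x q.1 - x q.2) := by
      refine Finset.sum_le_sum fun q _ => ?_
      have h4 := aux_coulomb_lower d hd (x q.1 - x q.2)
      have h5 := parallelogram_law_with_norm ℝ (x q.1) (x q.2)
      nlinarith [sq_nonneg ‖x q.1 + x q.2‖]
    rw [Finset.sum_neg_distrib] at h3
    linarith
  have h6 := mul_le_mul_of_nonneg_left hpair (show 0 ≤ 1 / (n : ℝ) ^ 2 by positivity)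
  have h7 : 1 / (n : ℝ) ^ 2 * (-((n : ℝ) * S / 4) - (n : ℝ) ^ 2 * (Real.log 8 / 2))
      = -(1 / (n : ℝ) * S / 4) - Real.log 8 / 2 := by
    field_simp
  have h8 : 1 / (2 * (n : ℝ)) * S = 1 / (n : ℝ) * S / 2 := by
    field_simp
  have h9 : 0 ≤ 1 / (n : ℝ) * S := by positivity
  rw [h8]
  linarith

theorem aux_gauss (d : ℕ) (b : ℝ) (hb : 0 < b) :
    Integrable (fun x : Euc d => Real.exp (-b * ‖x‖ ^ 2)) := by
  have h := (GaussianFourier.integrable_cexp_neg_mul_sq_norm_add (V := Euc d) (b := (b : ℂ))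
    (by simpa using hb) 0 0).norm
  refine h.congr (Filter.Eventually.of_forall fun x => ?_)
  simp only [Complex.norm_exp]
  congr 1
  simp [← Complex.ofReal_pow]

theorem aux_Z_fin (d n : ℕ) (hd : 2 ≤ d) (hn : 2 ≤ n) (β : ℝ) (hβ : 0 < β) (V : Euc d → ℝ)
    (hV : ∀ x, V x = ‖x‖ ^ 2) :
    ∫⁻ x, ENNReal.ofReal (Real.exp (-β * hamiltonian d n V x))
      ∂(Measure.pi fun _ : Fin n => (volume : Measure (Euc d))) ≠ ⊤ := by
  have hn0 : (0 : ℝ) < n := by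
    have : 0 < n := by omega
    exact_mod_cast this
  set b : ℝ := β * (1 / (2 * (n : ℝ))) with hb
  have hb0 : 0 < b := by positivity
  have hint : Integrable (fun x : Fin n → Euc d => ∏ i, Real.exp (-b * ‖x i‖ ^ 2))
      (Measure.pi fun _ : Fin n => (volume : Measure (Euc d))) :=
    Integrable.fintype_prod (fun _ => aux_gauss d b hb0)
  have hint2 := hint.const_mul (Real.exp (β * (Real.log 8 / 2)))
  refine ne_of_lt (lt_of_le_of_lt (lintegral_mono fun x => ?_) hint2.lintegral_lt_top)
  refine ENNReal.ofReal_le_ofReal ?_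
  rw [← Real.exp_sum, ← Real.exp_add, Real.exp_le_exp, ← Finset.mul_sum]
  have := mul_le_mul_of_nonneg_left (aux_ham_lower d n hd hn V hV x) hβ.le
  rw [hb]
  linarith

theorem aux_ham_shift (d n : ℕ) (hn : 2 ≤ n) (V : Euc d → ℝ) (hV : ∀ x, V x = ‖x‖ ^ 2)
    (v : Euc d) (hv : ‖v‖ = 1) (x : Fin n → Euc d) (t : ℝ) :
    hamiltonian d n V (fun i => x i - t • v) = hamiltonian d n V x
      - 2 * t * ((1 / (n : ℝ)) * ∑ i, ⟪x i, v⟫) + t ^ 2 := by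
  have hn0 : (n : ℝ) ≠ 0 := by
    have : n ≠ 0 := by omega
    exact_mod_cast this
  unfold hamiltonian
  simp only [hV, sub_sub_sub_cancel_right]
  have h1 : ∀ i, ‖x i - t • v‖ ^ 2 = ‖x i‖ ^ 2 - 2 * t * ⟪x i, v⟫ + t ^ 2 := by
    intro i
    rw [norm_sub_sq_real, norm_smul, hv, real_inner_smul_right]
    simp
    ring
  simp only [h1, Finset.sum_add_distrib, Finset.sum_sub_distrib, Finset.sum_const,
    Finset.card_univ, Fintype.card_fin, nsmul_eq_mul, ← Finset.mul_sum]
  field_simp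
  ring

/-- quadratic confinement with linear constraint `φ(x) = x·v - c`:
the law of the gas conditioned on `(1/n) Σ φ(X_i) = 0` (defined through a weakly
continuous disintegration of `P_n` along `x ↦ (1/n) Σ φ(x_i)`) equals the law of
`X + (c - s(X)·v)(v,…,v)`. -/
theorem stmt1 (d n : ℕ) (hd : 2 ≤ d) (hn : 2 ≤ n) (β : ℝ) (hβ : 0 < β)
    (V : Euc d → ℝ) (hV : ∀ x, V x = ‖x‖ ^ 2)
    (v : Euc d) (hv : ‖v‖ = 1) (c : ℝ)
    -- the disintegration of `P_n` along the linear statistics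
    (κ : ℝ → Measure (Fin n → Euc d)) (hκmeas : Measurable κ)
    (hκprob : ∀ z, IsProbabilityMeasure (κ z))
    (hκsupp : ∀ z : ℝ, κ z {x | (1 / (n : ℝ)) * ∑ i, (⟪(x i), v⟫ - c) ≠ z} = 0)
    (hκcont : ∀ f : BoundedContinuousFunction (Fin n → Euc d) ℝ,
      Continuous fun z => ∫ x, f x ∂(κ z))
    (hκdisint : gibbs d n β V =
      ((gibbs d n β V).map (fun x => (1 / (n : ℝ)) * ∑ i, (⟪(x i), v⟫ - c))).bind κ) :
    κ 0 = (gibbs d n β V).map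
      (fun x i => x i + (c - ((1 / (n : ℝ)) * ∑ j, ⟪(x j), v⟫)) • v) := by
  have hn0 : (n : ℝ) ≠ 0 := by
    have : n ≠ 0 := by omega
    exact_mod_cast this
  have hvv : ⟪v, v⟫ = (1 : ℝ) := by rw [real_inner_self_eq_norm_sq, hv]; norm_num
  set s : (Fin n → Euc d) → ℝ := fun x => (1 / (n : ℝ)) * ∑ i, (⟪(x i), v⟫ - c) with hs
  have hs' : ∀ x, s x = (1 / (n : ℝ)) * ∑ i, ⟪(x i), v⟫ - c := by
    intro x
    simp only [hs, Finset.sum_sub_distrib, Finset.sum_const, Finset.card_univ, Fintype.card_fin,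
      nsmul_eq_mul]
    field_simp
  have hsc : Continuous s := by fun_prop
  have hHm := aux_ham_meas d n V hV
  set ρ : (Fin n → Euc d) → ℝ≥0∞ :=
    fun x => ENNReal.ofReal (Real.exp (-β * hamiltonian d n V x)) with hρ
  have hρm : Measurable ρ := by fun_prop
  set γ : ℝ → ℝ≥0∞ := fun t => ENNReal.ofReal (Real.exp (-β * (t ^ 2 + 2 * c * t))) with hγ
  have hγm : Measurable γ := by fun_prop
  have hγfin : ∫⁻ t, γ t ≠ ⊤ := by
    have hint := (((integrable_exp_neg_mul_sq hβ).comp_add_right c).const_mul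
      (Real.exp (β * c ^ 2)))
    refine ne_of_lt (lt_of_le_of_lt (lintegral_mono fun t => ?_) hint.lintegral_lt_top)
    refine ENNReal.ofReal_le_ofReal (le_of_eq ?_)
    rw [← Real.exp_add]
    congr 1
    ring
  have hZ0 : ∫⁻ x, ρ x ∂(Measure.pi fun _ : Fin n => (volume : Measure (Euc d))) ≠ 0 := by
    rw [Ne, lintegral_eq_zero_iff hρm]
    intro h
    have h2 : ∀ᵐ x ∂(Measure.pi fun _ : Fin n => (volume : Measure (Euc d))), False := by
      refine h.mono fun x hx => ?_
      have : 0 < ρ x := ENNReal.ofReal_pos.mpr (Real.exp_pos _)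
      exact this.ne' hx
    have h3 := h2.exists
    obtain ⟨_, hx⟩ := h3
    exact hx
  have main := aux_abstract (Measure.pi fun _ : Fin n => (volume : Measure (Euc d)))
    (fun _ => v) (fun t F => lintegral_add_right_eq_self F _) s hsc ?_ ρ hρm γ hγm
    (fun t => (ENNReal.ofReal_pos.mpr (Real.exp_pos _)).ne') hγfin ?_ hZ0
    (aux_Z_fin d n hd hn β hβ V hV) κ hκmeas hκprob hκsupp hκcont (gibbs d n β V) rfl hκdisint
  · rw [main]
    congr 1
    funext x i
    simp only [Pi.sub_apply, Pi.smul_apply, hs' x]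
    module
  · intro x t
    rw [hs', hs']
    simp only [Pi.add_apply, Pi.smul_apply, inner_add_left, real_inner_smul_left, hvv,
      Finset.sum_add_distrib, Finset.sum_const, Finset.card_univ, Fintype.card_fin, nsmul_eq_mul]
    field_simp
    ring
  · intro x
    have h1 := aux_ham_shift d n hn V hV v hv x (s x)
    have h2 : (x - s x • fun _ => v) = fun i => x i - s x • v := rfl
    simp only [hρ, hγ]
    rw [h2, h1, ← ENNReal.ofReal_mul (Real.exp_pos _).le, ← Real.exp_add]
    have h3 : (1 / (n : ℝ)) * ∑ i, ⟪(x i), v⟫ = s x + c := by rw [hs' x]; ring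
    rw [h3]
    congr 2
    ring

end
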